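/- Let p be a prime number, C a finite subset of ℚ_p with at least two elements, α ∈ C, and let B = {x ∈ C : |x − α|_p < μ(C)} be the branch of C containing α. Then Σ_{x∈C} |x − α|_p = N·μ(C) + r, where N = #(C ∖ B) is a natural number and the remainder r = Σ_{x∈B} |x − α|_p satisfies 0 ≤ r ≤ (#B − 1)·μ(C)/p. In particular, Σ_{x∈C} |x − α|_p / μ(C) equals a natural number plus a term bounded by (#B − 1)/p. -/

import Mathlib

open Finset
open scoped Classical

/-- The diameter `μ(C) = max {‖x - y‖ : x, y ∈ C}` of a finite set of `p`-adic numbers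
(by convention `0` for the empty set). -/
noncomputable def mu {p : ℕ} [Fact p.Prime] (C : Finset ℚ_[p]) : ℝ :=
  if h : C.Nonempty then (C ×ˢ C).sup' (h.product h) (fun xy => ‖xy.1 - xy.2‖) else 0

/-- Distances between points of `C` are bounded by the diameter. -/
theorem norm_sub_le_mu {p : ℕ} [Fact p.Prime] {C : Finset ℚ_[p]} {x y : ℚ_[p]}
    (hx : x ∈ C) (hy : y ∈ C) : ‖x - y‖ ≤ mu C := by
  rw [mu, dif_pos ⟨x, hx⟩]
  exact Finset.le_sup' (fun xy : ℚ_[p] × ℚ_[p] => ‖xy.1 - xy.2‖)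
    (Finset.mk_mem_product hx hy)

/-- The diameter of a nonempty finite set is attained. -/
theorem exists_norm_sub_eq_mu {p : ℕ} [Fact p.Prime] {C : Finset ℚ_[p]} (hC : C.Nonempty) :
    ∃ x ∈ C, ∃ y ∈ C, mu C = ‖x - y‖ := by
  rw [mu, dif_pos hC]
  obtain ⟨⟨x, y⟩, hxy, h⟩ := Finset.exists_mem_eq_sup' (hC.product hC)
    (fun xy : ℚ_[p] × ℚ_[p] => ‖xy.1 - xy.2‖)
  exact ⟨x, (Finset.mem_product.1 hxy).1, y, (Finset.mem_product.1 hxy).2, h⟩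

/-- The `p`-adic norm takes only powers of `p` as nonzero values, so strict inequalities of norms
gain a factor `p`. -/
theorem padic_norm_le_div_of_lt {p : ℕ} [hp : Fact p.Prime] {a b : ℚ_[p]} (h : ‖a‖ < ‖b‖) :
    ‖a‖ ≤ ‖b‖ / p := by
  have hb : b ≠ 0 := norm_pos_iff.1 ((norm_nonneg a).trans_lt h)
  have hp0 : (p : ℝ) ≠ 0 := Nat.cast_ne_zero.2 hp.out.ne_zero
  rw [Padic.norm_eq_zpow_neg_valuation hb] at h ⊢
  rw [div_eq_mul_inv, ← zpow_sub_one₀ hp0,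
    Padic.norm_le_pow_iff_norm_lt_pow_add_one, sub_add_cancel]
  exact h

/-- Let `C ⊆ ℚ_p` be finite with at least two elements, `α ∈ C`, and
`B = {x ∈ C : ‖x - α‖ < μ(C)}` the branch of `C` containing `α`.  Then
`Σ_{x∈C} ‖x - α‖ = N·μ(C) + r` with `N = #(C \ B)` a natural number and the remainder
`r = Σ_{x∈B} ‖x - α‖` satisfying `0 ≤ r ≤ (#B - 1)·μ(C)/p`. -/
theorem energy_eq_nat_mul_mu_add_small {p : ℕ} [Fact p.Prime]
    (C : Finset ℚ_[p]) (hC : 2 ≤ C.card) (α : ℚ_[p]) (hα : α ∈ C)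
    (B : Finset ℚ_[p]) (hB : ∀ x, x ∈ B ↔ x ∈ C ∧ ‖x - α‖ < mu C) :
    ∑ x ∈ C, ‖x - α‖ = ((C \ B).card : ℝ) * mu C + ∑ x ∈ B, ‖x - α‖ ∧
    0 ≤ ∑ x ∈ B, ‖x - α‖ ∧
    ∑ x ∈ B, ‖x - α‖ ≤ ((B.card : ℝ) - 1) * mu C / p := by
  obtain ⟨u, hu, v, hv, huv⟩ := exists_norm_sub_eq_mu ⟨α, hα⟩
  obtain ⟨x, hx, y, hy, hxy⟩ := Finset.one_lt_card.1 hC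
  have hmu : 0 < mu C := (norm_pos_iff.2 (sub_ne_zero.2 hxy)).trans_le (norm_sub_le_mu hx hy)
  have hBC : B ⊆ C := fun z hz => ((hB z).1 hz).1
  have hαB : α ∈ B := (hB α).2 ⟨hα, by simpa using hmu⟩
  refine ⟨?_, Finset.sum_nonneg fun z _ => norm_nonneg _, ?_⟩
  · have hfar : ∀ z ∈ C \ B, ‖z - α‖ = mu C := by
      intro z hz
      obtain ⟨hzC, hzB⟩ := Finset.mem_sdiff.1 hz
      exact (norm_sub_le_mu hzC hα).antisymm (not_lt.1 fun hlt => hzB ((hB z).2 ⟨hzC, hlt⟩))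
    rw [← Finset.sum_sdiff hBC, Finset.sum_congr rfl hfar, Finset.sum_const, nsmul_eq_mul]
  · have hnear : ∀ z ∈ B.erase α, ‖z - α‖ ≤ mu C / p := by
      intro z hz
      have hlt := ((hB z).1 (Finset.mem_of_mem_erase hz)).2
      rw [huv] at hlt ⊢
      exact padic_norm_le_div_of_lt hlt
    have hsum := Finset.sum_le_card_nsmul _ _ _ hnear
    rw [nsmul_eq_mul, Finset.cast_card_erase_of_mem hαB] at hsum
    rw [← Finset.add_sum_erase B _ hαB, sub_self, norm_zero, zero_add, mul_div_assoc]
    exact hsum
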